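/- arXiv:2603.23239 — 4 statements merged into one kernel-verified Lean document; each statement's English description precedes it below -/
import Mathlib

section
/- Let L > 0 and let u : [0,L] → ℝ be continuously differentiable with u(0) = 0. Then ∫₀ᴸ |u(x) u'(x)| dx ≤ (L/2) ∫₀ᴸ (u'(x))² dx. -/
/-- **Olech–Opial inequality.** If `u : [0,L] → ℝ` is continuously differentiable
with `u 0 = 0`, then `∫₀ᴸ |u u'| ≤ (L/2) ∫₀ᴸ (u')²`. -/
theorem olech_opial (L : ℝ) (hL : 0 < L) (u u' : ℝ → ℝ)
    (hderiv : ∀ x ∈ Set.Icc (0 : ℝ) L, HasDerivAt u (u' x) x)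
    (hcont : ContinuousOn u' (Set.Icc (0 : ℝ) L))
    (hu0 : u 0 = 0) :
    ∫ x in (0 : ℝ)..L, |u x * u' x| ≤ (L / 2) * ∫ x in (0 : ℝ)..L, (u' x) ^ 2 := by
  obtain ⟨w, hw, hwu⟩ : ∃ w : ℝ → ℝ, Continuous w ∧ ∀ x ∈ Set.Icc (0 : ℝ) L, w x = u' x := by
    refine ⟨Set.IccExtend hL.le ((Set.Icc (0 : ℝ) L).domRestrict u'), ?_, ?_⟩
    · exact (continuousOn_iff_continuous_domRestrict.mp hcont).Icc_extend'
    · intro x hx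
      rw [Set.IccExtend_of_mem _ _ hx]
      rfl
  have hg : Continuous fun x => |w x| := hw.abs
  set v : ℝ → ℝ := fun x => ∫ t in (0 : ℝ)..x, |w t| with hv
  have hvd : ∀ x, HasDerivAt v |w x| x := fun x => hg.integral_hasStrictDerivAt 0 x |>.hasDerivAt
  have hvc : Continuous v := continuous_iff_continuousAt.mpr fun x => (hvd x).continuousAt
  have hv0 : v 0 = 0 := by simp [hv]
  have huv : ∀ x ∈ Set.Icc (0 : ℝ) L, |u x| ≤ v x := by
    intro x hx
    have h1 : ∫ t in (0 : ℝ)..x, w t = u x - u 0 := by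
      apply intervalIntegral.integral_eq_sub_of_hasDerivAt _ (hw.intervalIntegrable _ _)
      intro t ht
      rw [Set.uIcc_of_le hx.1] at ht
      have ht' : t ∈ Set.Icc (0 : ℝ) L := ⟨ht.1, ht.2.trans hx.2⟩
      rw [hwu t ht']
      exact hderiv t ht'
    rw [hu0, sub_zero] at h1
    rw [← h1]
    exact intervalIntegral.abs_integral_le_integral_abs hx.1
  have huc : ContinuousOn u (Set.Icc (0 : ℝ) L) :=
    fun x hx => (hderiv x hx).continuousAt.continuousWithinAt
  have hA : ∫ x in (0 : ℝ)..L, |u x * u' x| ≤ ∫ x in (0 : ℝ)..L, v x * |w x| := by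
    apply intervalIntegral.integral_mono_on hL.le
    · apply ContinuousOn.intervalIntegrable
      rw [Set.uIcc_of_le hL.le]
      exact (huc.mul hcont).abs
    · exact (hvc.mul hg).intervalIntegrable _ _
    · intro x hx
      rw [abs_mul, ← hwu x hx]
      exact mul_le_mul_of_nonneg_right (huv x hx) (abs_nonneg _)
  have hB : ∫ x in (0 : ℝ)..L, v x * |w x| = v L ^ 2 / 2 := by
    have := intervalIntegral.integral_eq_sub_of_hasDerivAt (a := 0) (b := L)
      (f := fun x => v x ^ 2 / 2) (f' := fun x => v x * |w x|)
      (fun x _ => by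
        have := ((hvd x).pow 2).div_const 2
        refine HasDerivAt.congr_deriv this ?_
        norm_num
        ring) ((hvc.mul hg).intervalIntegrable _ _)
    rw [this, hv0]
    ring
  have hC : ∫ x in (0 : ℝ)..L, (u' x) ^ 2 = ∫ x in (0 : ℝ)..L, (w x) ^ 2 := by
    apply intervalIntegral.integral_congr
    intro x hx
    rw [Set.uIcc_of_le hL.le] at hx
    simp only [hwu x hx]
  have hD : 0 ≤ ∫ x in (0 : ℝ)..L, (L * |w x| - v L) ^ 2 :=
    intervalIntegral.integral_nonneg hL.le fun x _ => sq_nonneg _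
  have hE : ∫ x in (0 : ℝ)..L, (L * |w x| - v L) ^ 2
      = L ^ 2 * (∫ x in (0 : ℝ)..L, (w x) ^ 2) - 2 * L * v L * v L + L * v L ^ 2 := by
    have h1 : ∀ x, (L * |w x| - v L) ^ 2
        = L ^ 2 * (w x) ^ 2 - 2 * L * v L * |w x| + v L ^ 2 := by
      intro x
      rw [← sq_abs (w x)]
      ring
    simp_rw [h1]
    rw [intervalIntegral.integral_add, intervalIntegral.integral_sub,
      intervalIntegral.integral_const_mul, intervalIntegral.integral_const_mul,
      intervalIntegral.integral_const]
    · simp [hv]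
    all_goals
      apply Continuous.intervalIntegrable
      fun_prop
  rw [hC]
  rw [hE] at hD
  have hF : v L ^ 2 ≤ L * ∫ x in (0 : ℝ)..L, (w x) ^ 2 := by
    have : 0 ≤ L * (L * (∫ x in (0 : ℝ)..L, (w x) ^ 2) - v L ^ 2) := by linarith
    have := nonneg_of_mul_nonneg_right this hL
    linarith
  linarith
end

section
/- Let L > 0, μ > 0, p > 1, and let u : [0,L] → ℝ be twice continuously differentiable with u(0) = u(L) = 0, u(x) > 0 for x ∈ (0,L), u(x) = u(L−x) for all x ∈ [0,L], u'(x) > 0 for x ∈ (0, L/2), and −u''(x) = μ u(x)^p on [0,L]. Set A = u(L/2). Then μ = 2 B(1/(p+1), 1/2)² / ((p+1) L² A^{p−1}). -/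
/-- The Euler Beta function `B(a,b) = ∫₀¹ t^(a−1) (1−t)^(b−1) dt`. -/
noncomputable def eulerBeta (a b : ℝ) : ℝ :=
  ∫ t in (0 : ℝ)..1, t ^ (a - 1) * (1 - t) ^ (b - 1)

/-- For a positive symmetric solution of the Emden–Fowler Dirichlet problem
`−u'' = μ u^p`, `u 0 = u L = 0`, with maximum `A = u(L/2)`, the Lagrange
multiplier satisfies `μ = 2 B(1/(p+1), 1/2)² / ((p+1) L² A^(p−1))`. -/
theorem emden_fowler_multiplier (L mu p : ℝ) (hL : 0 < L) (hmu : 0 < mu) (hp : 1 < p)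
    (u u' u'' : ℝ → ℝ)
    (hd1 : ∀ x ∈ Set.Icc (0 : ℝ) L, HasDerivAt u (u' x) x)
    (hd2 : ∀ x ∈ Set.Icc (0 : ℝ) L, HasDerivAt u' (u'' x) x)
    (hc : ContinuousOn u'' (Set.Icc (0 : ℝ) L))
    (hu0 : u 0 = 0) (huL : u L = 0)
    (hpos : ∀ x ∈ Set.Ioo (0 : ℝ) L, 0 < u x)
    (hsym : ∀ x ∈ Set.Icc (0 : ℝ) L, u x = u (L - x))
    (hmono : ∀ x ∈ Set.Ioo (0 : ℝ) (L / 2), 0 < u' x)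
    (heq : ∀ x ∈ Set.Icc (0 : ℝ) L, -u'' x = mu * u x ^ p) :
    mu = 2 * (eulerBeta (1 / (p + 1)) (1 / 2)) ^ 2 /
      ((p + 1) * L ^ 2 * (u (L / 2)) ^ (p - 1)) := by
  have hA : 0 < u (L / 2) := hpos _ ⟨by linarith, by linarith⟩
  have hmid : L / 2 ∈ Set.Icc (0 : ℝ) L := ⟨by linarith, by linarith⟩
  have hu'mid : u' (L / 2) = 0 := by
    have h1 := hd1 (L / 2) hmid
    have h2 : HasDerivAt (fun x => u (L - x)) (-u' (L / 2)) (L / 2) := by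
      have h1' : HasDerivAt u (u' (L / 2)) (L - L / 2) := by
        rw [show L - L / 2 = L / 2 by ring]; exact h1
      simpa using h1'.comp_const_sub L (L / 2)
    have h3 : HasDerivAt u (-u' (L / 2)) (L / 2) := by
      refine h2.congr_of_eventuallyEq ?_
      filter_upwards [Icc_mem_nhds (show 0 < L / 2 by linarith) (show L / 2 < L by linarith)] with x hx
      exact hsym x hx
    have := h1.unique h3
    linarith
  set A := u (L / 2) with hAdef
  have hp1 : 0 < p + 1 := by linarith
  have hE : ∀ x ∈ Set.Icc (0 : ℝ) L, HasDerivAt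
      (fun x => u' x ^ 2 + 2 * mu / (p + 1) * u x ^ (p + 1)) 0 x := by
    intro x hx
    have h := ((hd2 x hx).pow 2).add
      (((hd1 x hx).rpow_const (p := p + 1) (Or.inr (by linarith))).const_mul (2 * mu / (p + 1)))
    refine HasDerivAt.congr_deriv h ?_
    have := heq x hx
    rw [show u'' x = -(mu * u x ^ p) by linarith, show p + 1 - 1 = p by ring]
    field_simp
    ring
  have henergy : ∀ x ∈ Set.Ioo (0 : ℝ) (L / 2),
      u' x ^ 2 = 2 * mu / (p + 1) * (A ^ (p + 1) - u x ^ (p + 1)) := by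
    intro x hx
    have h := (convex_Icc (0 : ℝ) L).is_const_of_fderivWithin_eq_zero (𝕜 := ℝ)
      (f := fun x => u' x ^ 2 + 2 * mu / (p + 1) * u x ^ (p + 1))
      (fun y hy => (hE y hy).differentiableAt.differentiableWithinAt)
      (fun y hy => by
        have h5 := (hE y hy).hasFDerivAt.hasFDerivWithinAt (s := Set.Icc 0 L)
        rw [h5.fderivWithin (uniqueDiffOn_Icc hL y hy)]
        ext; simp)
      (x := x) (y := L / 2) ⟨hx.1.le, by linarith [hx.2]⟩ hmid
    simp only [hu'mid, ← hAdef] at h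
    linarith
  have hB : eulerBeta (1 / (p + 1)) (1 / 2)
      = L / 2 * √(2 * (p + 1) * mu * A ^ (p - 1)) := by
    have hcv := intervalIntegral.integral_comp_mul_deriv_of_deriv_nonneg (a := 0) (b := L / 2)
      (f := fun x => (u x / A) ^ (p + 1))
      (f' := fun x => (u' x / A) * (p + 1) * (u x / A) ^ (p + 1 - 1))
      (g := fun t => t ^ (1 / (p + 1) - 1) * (1 - t) ^ ((1 : ℝ) / 2 - 1))
      ?_ ?_ ?_
    · unfold eulerBeta
      simp only [hu0, ← hAdef, zero_div, div_self hA.ne', Real.one_rpow,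
        Real.zero_rpow hp1.ne'] at hcv
      rw [← hcv]
      have hle : (0 : ℝ) ≤ L / 2 := by linarith
      rw [intervalIntegral.integral_of_le hle, MeasureTheory.integral_Ioc_eq_integral_Ioo,
        MeasureTheory.setIntegral_congr_fun (g := fun _ => √(2 * (p + 1) * mu * A ^ (p - 1)))
          measurableSet_Ioo]
      · simp [hle]
      · intro x hx
        have hux : 0 < u x := hpos x ⟨hx.1, by linarith [hx.2]⟩
        have hu' := hmono x hx
        have hen := henergy x hx
        have hv : 0 < u x / A := by positivity
        simp only [Function.comp]
        set v := u x / A with hvdef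
        have huv : u x = A * v := by rw [hvdef]; field_simp
        have e1 : (v ^ (p + 1)) ^ (1 / (p + 1) - 1) * v ^ (p + 1 - 1) = 1 := by
          rw [← Real.rpow_mul hv.le, ← Real.rpow_add hv]
          rw [show (p + 1) * (1 / (p + 1) - 1) + (p + 1 - 1) = 0 by field_simp; ring]
          exact Real.rpow_zero v
        rw [huv, Real.mul_rpow hA.le hv.le] at hen
        set s := 1 - v ^ (p + 1) with hs
        have hen2 : u' x ^ 2 = 2 * mu / (p + 1) * A ^ (p + 1) * s := by
          rw [hen, hs]; ring
        have hspos : 0 < s := by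
          have h0 : 0 < 2 * mu / (p + 1) * A ^ (p + 1) := by positivity
          have h1 : 0 < 2 * mu / (p + 1) * A ^ (p + 1) * s := by rw [← hen2]; positivity
          exact (mul_pos_iff_of_pos_left h0).mp h1
        have e2 : s ^ ((1 : ℝ) / 2 - 1) = (√s)⁻¹ := by
          rw [show (1 : ℝ) / 2 - 1 = -(1 / 2) by norm_num, Real.rpow_neg hspos.le,
            Real.sqrt_eq_rpow]
        have hApow : A ^ (p + 1) = A ^ (p - 1) * A ^ 2 := by
          rw [← Real.rpow_natCast A 2, ← Real.rpow_add hA]; norm_num; ring_nf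
        rw [e2]
        have e3 : (v ^ (p + 1)) ^ (1 / (p + 1) - 1) * (√s)⁻¹ *
            (u' x / A * (p + 1) * v ^ (p + 1 - 1)) = (√s)⁻¹ * (u' x / A * (p + 1)) := by
          linear_combination ((√s)⁻¹ * (u' x / A * (p + 1))) * e1
        rw [e3]
        symm
        rw [Real.sqrt_eq_iff_eq_sq (by positivity) (by positivity)]
        · have hsq : √s ^ 2 = s := Real.sq_sqrt hspos.le
          rw [mul_pow, inv_pow, hsq, mul_pow, div_pow, hen2, hApow]
          field_simp
    · refine ContinuousOn.rpow_const ?_ (fun x _ => Or.inr hp1.le)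
      refine ContinuousOn.div_const ?_ _
      intro x hx
      rw [Set.uIcc_of_le (by linarith)] at hx
      exact (hd1 x ⟨hx.1, by linarith [hx.2]⟩).continuousAt.continuousWithinAt
    · intro x hx
      rw [min_eq_left (by linarith), max_eq_right (by linarith)] at hx
      exact ((hd1 x ⟨hx.1.le, by linarith [hx.2]⟩).div_const A).rpow_const
        (Or.inr (by linarith))
    · intro x hx
      rw [min_eq_left (by linarith), max_eq_right (by linarith)] at hx
      have := hmono x hx
      have hux : 0 < u x := hpos x ⟨hx.1, by linarith [hx.2]⟩
      positivity
  have hAp : 0 < A ^ (p - 1) := by positivity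
  rw [hB, mul_pow, Real.sq_sqrt (by positivity)]
  field_simp
end

section
/- Let L > 0, μ > 0, p > 1, and let u : [0,L] → ℝ be twice continuously differentiable with u(0) = u(L) = 0, u(x) > 0 for x ∈ (0,L), u(x) = u(L−x) for all x ∈ [0,L], u'(x) > 0 for x ∈ (0, L/2), and −u''(x) = μ u(x)^p on [0,L]. Set A = u(L/2). Then ∫₀ᴸ u(x)^{p+1} dx = L A^{p+1} B((p+2)/(p+1), 1/2) / B(1/(p+1), 1/2). -/
/-- The real Beta integral agrees with the Gamma quotient. -/
lemma eulerBeta_eq_beta (a b : ℝ) (ha : 0 < a) (hb : 0 < b) :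
    eulerBeta a b = ProbabilityTheory.beta a b := by
  rw [ProbabilityTheory.beta_eq_betaIntegralReal a b ha hb]
  have h : Complex.betaIntegral a b = ((eulerBeta a b : ℝ) : ℂ) := by
    unfold Complex.betaIntegral eulerBeta
    rw [← intervalIntegral.integral_ofReal]
    apply intervalIntegral.integral_congr
    intro x hx
    rw [Set.uIcc_of_le zero_le_one] at hx
    have h1 : 0 ≤ 1 - x := by linarith [hx.2]
    simp only
    push_cast
    rw [Complex.ofReal_cpow hx.1, Complex.ofReal_cpow h1]
    push_cast
    rfl
  rw [h, Complex.ofReal_re]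

lemma eulerBeta_ratio (p : ℝ) (hp : 1 < p) :
    0 < eulerBeta (1 / (p + 1)) (1 / 2) ∧
    eulerBeta ((p + 2) / (p + 1)) (1 / 2) * (p + 3) = 2 * eulerBeta (1 / (p + 1)) (1 / 2) := by
  have hp1 : 0 < p + 1 := by linarith
  have ha : 0 < 1 / (p + 1) := by positivity
  have hb : (0 : ℝ) < 1 / 2 := by norm_num
  have e : (p + 2) / (p + 1) = 1 / (p + 1) + 1 := by field_simp; ring
  rw [e, eulerBeta_eq_beta _ _ ha hb, eulerBeta_eq_beta _ _ (by positivity) hb]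
  refine ⟨ProbabilityTheory.beta_pos ha hb, ?_⟩
  unfold ProbabilityTheory.beta
  have e2 : 1 / (p + 1) + 1 + 1 / 2 = (1 / (p + 1) + 1 / 2) + 1 := by ring
  have hs : 0 < 1 / (p + 1) + 1 / 2 := by positivity
  have e3 : 1 / (p + 1) + 1 / 2 = (p + 3) / (2 * (p + 1)) := by field_simp; ring
  rw [e2, Real.Gamma_add_one ha.ne', Real.Gamma_add_one hs.ne']
  have hG := Real.Gamma_pos_of_pos hs
  generalize Real.Gamma (1 / (p + 1) + 1 / 2) = G at *
  generalize Real.Gamma (1 / (p + 1)) = G1 at *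
  generalize Real.Gamma (1 / 2) = G2 at *
  rw [e3]
  have : p + 3 ≠ 0 := by linarith
  field_simp

/-- For a positive symmetric solution of the Emden–Fowler Dirichlet problem
`−u'' = μ u^p`, `u 0 = u L = 0`, with maximum `A = u(L/2)`, one has
`∫₀ᴸ u^(p+1) = L A^(p+1) B((p+2)/(p+1), 1/2) / B(1/(p+1), 1/2)`. -/
theorem emden_fowler_nonlinear_energy (L mu p : ℝ) (hL : 0 < L) (hmu : 0 < mu)
    (hp : 1 < p) (u u' u'' : ℝ → ℝ)
    (hd1 : ∀ x ∈ Set.Icc (0 : ℝ) L, HasDerivAt u (u' x) x)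
    (hd2 : ∀ x ∈ Set.Icc (0 : ℝ) L, HasDerivAt u' (u'' x) x)
    (hc : ContinuousOn u'' (Set.Icc (0 : ℝ) L))
    (hu0 : u 0 = 0) (huL : u L = 0)
    (hpos : ∀ x ∈ Set.Ioo (0 : ℝ) L, 0 < u x)
    (hsym : ∀ x ∈ Set.Icc (0 : ℝ) L, u x = u (L - x))
    (hmono : ∀ x ∈ Set.Ioo (0 : ℝ) (L / 2), 0 < u' x)
    (heq : ∀ x ∈ Set.Icc (0 : ℝ) L, -u'' x = mu * u x ^ p) :
    ∫ x in (0 : ℝ)..L, u x ^ (p + 1)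
      = L * (u (L / 2)) ^ (p + 1) * eulerBeta ((p + 2) / (p + 1)) (1 / 2) /
          eulerBeta (1 / (p + 1)) (1 / 2) := by
  have hp1 : 0 < p + 1 := by linarith
  have hnn : ∀ x ∈ Set.Icc (0 : ℝ) L, 0 ≤ u x := by
    intro x hx
    rcases hx.1.eq_or_lt with h | h
    · rw [← h, hu0]
    rcases hx.2.eq_or_lt with h' | h'
    · rw [h', huL]
    exact (hpos x ⟨h, h'⟩).le
  have hm : L / 2 ∈ Set.Icc (0 : ℝ) L := ⟨by linarith, by linarith⟩
  have hmid : u' (L / 2) = 0 := by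
    have h1 := hd1 _ hm
    have h2 : HasDerivAt (fun x => u (L - x)) (-u' (L / 2)) (L / 2) := by
      have h3 : HasDerivAt u (u' (L / 2)) (L - L / 2) := by
        convert! h1 using 1
        ring
      exact h3.comp_const_sub L (L / 2)
    have h4 : u =ᶠ[nhds (L / 2)] (fun x => u (L - x)) := by
      filter_upwards [Icc_mem_nhds (show 0 < L / 2 by linarith) (show L / 2 < L by linarith)]
        with x hx using hsym x hx
    have h5 := h1.unique (h2.congr_of_eventuallyEq h4)
    linarith
  have hpow : ∀ x ∈ Set.Icc (0 : ℝ) L, u x ^ (p + 1) = u x ^ p * u x := fun x hx =>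
    Real.rpow_add_one' (hnn x hx) hp1.ne'
  have hG : ∀ x ∈ Set.Icc (0 : ℝ) L,
      HasDerivAt (fun x => u' x ^ 2 / 2 + mu / (p + 1) * u x ^ (p + 1)) 0 x := by
    intro x hx
    have h1 := ((hd2 x hx).pow 2).div_const 2
    have h2 := ((hd1 x hx).rpow_const (p := p + 1) (Or.inr (by linarith))).const_mul (mu / (p + 1))
    convert! h1.add h2 using 1
    have := heq x hx
    have h6 : u'' x = -(mu * u x ^ p) := by linarith
    rw [h6, add_sub_cancel_right]
    field_simp
    norm_num
  have hconst := constant_of_has_deriv_right_zero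
    (fun x hx => (hG x hx).continuousAt.continuousWithinAt)
    (fun x hx => (hG x ⟨hx.1, hx.2.le⟩).hasDerivWithinAt)
  have hE : ∀ x ∈ Set.Icc (0 : ℝ) L,
      u' x ^ 2 / 2 + mu / (p + 1) * u x ^ (p + 1) = mu / (p + 1) * u (L / 2) ^ (p + 1) := by
    intro x hx
    have h1 := hconst x hx
    have h2 := hconst _ hm
    simp only [hmid] at h1 h2
    linarith
  have hcu : ContinuousOn (fun x => u x ^ (p + 1)) (Set.Icc (0 : ℝ) L) := fun x hx =>
    ((hd1 x hx).continuousAt.rpow_const (Or.inr hp1.le)).continuousWithinAt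
  have hint : IntervalIntegrable (fun x => u x ^ (p + 1)) MeasureTheory.volume 0 L := by
    apply ContinuousOn.intervalIntegrable
    rwa [Set.uIcc_of_le hL.le]
  have hF : ∀ x ∈ Set.uIcc (0 : ℝ) L, HasDerivAt (fun x => u x * u' x)
      (2 * (mu / (p + 1) * u (L / 2) ^ (p + 1)) - mu * (p + 3) / (p + 1) * u x ^ (p + 1)) x := by
    intro x hx
    rw [Set.uIcc_of_le hL.le] at hx
    convert! (hd1 x hx).mul (hd2 x hx) using 1
    rw [← hE x hx]
    have h6 : u'' x = -(mu * u x ^ p) := by linarith [heq x hx]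
    rw [h6, hpow x hx]
    field_simp
    ring
  have hI := intervalIntegral.integral_eq_sub_of_hasDerivAt hF
    (intervalIntegrable_const.sub (hint.const_mul _))
  rw [intervalIntegral.integral_sub intervalIntegrable_const (hint.const_mul _),
    intervalIntegral.integral_const, intervalIntegral.integral_const_mul, hu0, huL] at hI
  obtain ⟨hB, hR⟩ := eulerBeta_ratio p hp
  rw [eq_div_iff hB.ne']
  generalize (∫ x in (0 : ℝ)..L, u x ^ (p + 1)) = I at *
  generalize eulerBeta (1 / (p + 1)) (1 / 2) = B at *
  generalize eulerBeta ((p + 2) / (p + 1)) (1 / 2) = C at *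
  generalize u (L / 2) ^ (p + 1) = D at *
  have hk : I * (p + 3) = 2 * L * D := by
    simp only [smul_eq_mul] at hI
    field_simp at hI
    apply mul_left_cancel₀ hmu.ne'
    linear_combination -hI
  have hp3 : p + 3 ≠ 0 := by linarith
  apply mul_right_cancel₀ hp3
  linear_combination B * hk - L * D * hR
end

section
/- Let L > 0, μ > 0, p > 1, and let u : [0,L] → ℝ be twice continuously differentiable with u(0) = u(L) = 0, u(x) > 0 for x ∈ (0,L), u(x) = u(L−x) for all x ∈ [0,L], u'(x) > 0 for x ∈ (0, L/2), and −u''(x) = μ u(x)^p on [0,L]. Set A = u(L/2). Then the Rayleigh-type quotient satisfies (∫₀ᴸ u(x)^{p+1} dx) / (∫₀ᴸ (u'(x))² dx)^{(p+1)/2} = L · ((p+1) L / 2)^{(p+1)/2} · B((p+2)/(p+1), 1/2)^{(1−p)/2} / B(1/(p+1), 1/2)^{(p+3)/2}. In particular, this value is independent of μ and A, and for p = 1 it equals L²/π². -/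
theorem eulerBeta_half : eulerBeta (1 / 2) (1 / 2) = Real.pi := by
  have h1 : ((eulerBeta (1/2) (1/2) : ℝ) : ℂ) = Complex.betaIntegral ((1/2 : ℝ) : ℂ) ((1/2 : ℝ) : ℂ) := by
    unfold eulerBeta Complex.betaIntegral
    rw [← intervalIntegral.integral_ofReal]
    apply intervalIntegral.integral_congr
    intro x hx
    rw [Set.uIcc_of_le zero_le_one] at hx
    have h2 : (0 : ℝ) ≤ 1 - x := by linarith [hx.2]
    simp only [Complex.ofReal_mul]
    rw [Complex.ofReal_cpow hx.1, Complex.ofReal_cpow h2]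
    push_cast
    rfl
  have h3 := ProbabilityTheory.beta_eq_betaIntegralReal (1/2) (1/2) (by norm_num) (by norm_num)
  rw [← h1, Complex.ofReal_re] at h3
  rw [← h3, ProbabilityTheory.beta]
  rw [Real.Gamma_one_half_eq, show (1/2 + 1/2 : ℝ) = 1 by norm_num, Real.Gamma_one, div_one,
    Real.mul_self_sqrt Real.pi_pos.le]

theorem ef_pointwise (q A v W d : ℝ) (hq : 0 < q) (hA : 0 < A) (hv : 0 < v) (hvA : v < A)
    (hW : 0 < W) (hd : 0 < d) (h : d ^ 2 = W ^ 2 * (1 - (v / A) ^ q)) :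
    |d / A * q * (v / A) ^ (q - 1)| *
      (((v / A) ^ q) ^ (1 / q - 1) * (1 - (v / A) ^ q) ^ ((1 : ℝ) / 2 - 1)) = q * W / A := by
  have hs : 0 < v / A := by positivity
  have hs1 : v / A < 1 := (div_lt_one hA).2 hvA
  have hf : 0 < 1 - (v / A) ^ q := by
    have := Real.rpow_lt_one hs.le hs1 hq
    linarith
  rw [abs_of_pos (by positivity), ← Real.rpow_mul hs.le]
  have e1 : (v / A) ^ (q - 1) * (v / A) ^ (q * (1 / q - 1)) = 1 := by
    rw [← Real.rpow_add hs]
    rw [show q - 1 + q * (1 / q - 1) = 0 by field_simp; ring, Real.rpow_zero]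
  have hd' : d = W * √(1 - (v / A) ^ q) := by
    rw [← Real.sqrt_sq hd.le, h, Real.sqrt_mul (by positivity), Real.sqrt_sq hW.le]
  have e2 : d * (1 - (v / A) ^ q) ^ ((1 : ℝ) / 2 - 1) = W := by
    rw [hd', Real.sqrt_eq_rpow, mul_assoc, ← Real.rpow_add hf]
    norm_num
  calc _ = (d * (1 - (v / A) ^ q) ^ ((1 : ℝ) / 2 - 1)) *
      ((v / A) ^ (q - 1) * (v / A) ^ (q * (1 / q - 1))) * q / A := by ring
    _ = _ := by rw [e1, e2]; ring

theorem ef_final (L mu p A K U B1 B2 : ℝ) (hL : 0 < L) (hmu : 0 < mu) (hp : 1 < p) (hA : 0 < A)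
    (hK : 0 < K) (hU : 0 < U) (hB1 : B1 = K * (L / 2)) (hB2 : B2 = K * (U / (2 * A ^ (p + 1))))
    (hK2 : K ^ 2 * A ^ 2 = 2 * (p + 1) * mu * A ^ (p + 1)) :
    U / (mu * U) ^ ((p + 1) / 2) = L * ((p + 1) * L / 2) ^ ((p + 1) / 2) *
          B2 ^ ((1 - p) / 2) / B1 ^ ((p + 3) / 2) := by
  have hq : 0 < p + 1 := by linarith
  have p1 : 0 < B1 := by rw [hB1]; positivity
  have p2 : 0 < B2 := by rw [hB2]; positivity
  apply Real.log_injOn_pos (by simp only [Set.mem_Ioi]; positivity)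
    (by simp only [Set.mem_Ioi]; positivity)
  have l1 : Real.log B1 = Real.log K + (Real.log L - Real.log 2) := by
    rw [hB1, Real.log_mul (by positivity) (by positivity), Real.log_div (by positivity) (by positivity)]
  have l2 : Real.log B2 = Real.log K + (Real.log U - (Real.log 2 + (p + 1) * Real.log A)) := by
    rw [hB2, Real.log_mul (by positivity) (by positivity), Real.log_div (by positivity) (by positivity),
      Real.log_mul (by positivity) (by positivity), Real.log_rpow hA]
  have l3 : 2 * Real.log K + 2 * Real.log A =
      Real.log 2 + Real.log (p + 1) + Real.log mu + (p + 1) * Real.log A := by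
    have := congrArg Real.log hK2
    rw [Real.log_mul (by positivity) (by positivity), Real.log_mul (by positivity) (by positivity),
      Real.log_mul (by positivity) (by positivity), Real.log_mul (by positivity) (by positivity),
      Real.log_rpow hA, Real.log_pow, Real.log_pow] at this
    exact_mod_cast this
  rw [Real.log_div (by positivity) (by positivity), Real.log_rpow (by positivity),
    Real.log_mul hmu.ne' hU.ne', Real.log_div (by positivity) (by positivity),
    Real.log_mul (by positivity) (by positivity), Real.log_mul (by positivity) (by positivity),
    Real.log_rpow (by positivity), Real.log_rpow p2, Real.log_rpow p1,
    Real.log_div (by positivity) (by positivity), Real.log_mul (by positivity) (by positivity), l1, l2]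
  have l4 : Real.log mu = 2 * Real.log K + 2 * Real.log A -
      (Real.log 2 + Real.log (p + 1) + (p + 1) * Real.log A) := by linarith
  rw [l4]
  ring

/-- For a positive symmetric solution of the Emden–Fowler Dirichlet problem
`−u'' = μ u^p`, `u 0 = u L = 0`, with maximum `A = u(L/2)`, the Rayleigh-type
quotient `(∫₀ᴸ u^(p+1)) / (∫₀ᴸ (u')²)^((p+1)/2)` equals
`L ((p+1)L/2)^((p+1)/2) B((p+2)/(p+1), 1/2)^((1−p)/2) / B(1/(p+1), 1/2)^((p+3)/2)`;
in particular it is independent of `μ` and `A`, and for `p = 1` this expression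
equals `L²/π²`. -/
theorem emden_fowler_rayleigh_quotient (L mu p : ℝ) (hL : 0 < L) (hmu : 0 < mu)
    (hp : 1 < p) (u u' u'' : ℝ → ℝ)
    (hd1 : ∀ x ∈ Set.Icc (0 : ℝ) L, HasDerivAt u (u' x) x)
    (hd2 : ∀ x ∈ Set.Icc (0 : ℝ) L, HasDerivAt u' (u'' x) x)
    (hc : ContinuousOn u'' (Set.Icc (0 : ℝ) L))
    (hu0 : u 0 = 0) (huL : u L = 0)
    (hpos : ∀ x ∈ Set.Ioo (0 : ℝ) L, 0 < u x)
    (hsym : ∀ x ∈ Set.Icc (0 : ℝ) L, u x = u (L - x))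
    (hmono : ∀ x ∈ Set.Ioo (0 : ℝ) (L / 2), 0 < u' x)
    (heq : ∀ x ∈ Set.Icc (0 : ℝ) L, -u'' x = mu * u x ^ p) :
    (∫ x in (0 : ℝ)..L, u x ^ (p + 1)) /
        (∫ x in (0 : ℝ)..L, (u' x) ^ 2) ^ ((p + 1) / 2)
      = L * ((p + 1) * L / 2) ^ ((p + 1) / 2) *
          (eulerBeta ((p + 2) / (p + 1)) (1 / 2)) ^ ((1 - p) / 2) /
          (eulerBeta (1 / (p + 1)) (1 / 2)) ^ ((p + 3) / 2) ∧
    L * (((1 : ℝ) + 1) * L / 2) ^ ((((1 : ℝ) + 1)) / 2) *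
        (eulerBeta (((1 : ℝ) + 2) / ((1 : ℝ) + 1)) (1 / 2)) ^ (((1 : ℝ) - 1) / 2) /
        (eulerBeta (1 / ((1 : ℝ) + 1)) (1 / 2)) ^ (((1 : ℝ) + 3) / 2)
      = L ^ 2 / Real.pi ^ 2 := by
  have hq : 0 < p + 1 := by linarith
  have hL2 : 0 < L / 2 := by linarith
  have hmid : L / 2 ∈ Set.Ioo (0 : ℝ) L := ⟨hL2, by linarith⟩
  refine ⟨?_, ?_⟩
  swap
  · rw [show (1 : ℝ) / (1 + 1) = 1 / 2 by norm_num, eulerBeta_half]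
    rw [show ((1 : ℝ) + 1) / 2 = 1 by norm_num, show ((1 : ℝ) - 1) / 2 = 0 by norm_num,
      show ((1 : ℝ) + 3) / 2 = (2 : ℕ) by norm_num, Real.rpow_one, Real.rpow_zero, Real.rpow_natCast]
    ring
  set A := u (L / 2) with hAdef
  have hA : 0 < A := hpos _ hmid
  have hnn : ∀ x ∈ Set.Icc (0 : ℝ) L, 0 ≤ u x := by
    intro x hx
    rcases hx.1.eq_or_lt with h | h
    · rw [← h, hu0]
    rcases hx.2.eq_or_lt with h' | h'
    · rw [h', huL]
    exact (hpos x ⟨h, h'⟩).le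
  have cu : ContinuousOn u (Set.Icc 0 L) := fun x hx => (hd1 x hx).continuousAt.continuousWithinAt
  have cu' : ContinuousOn u' (Set.Icc 0 L) := fun x hx => (hd2 x hx).continuousAt.continuousWithinAt
  have cuq : ContinuousOn (fun x => u x ^ (p + 1)) (Set.Icc 0 L) :=
    cu.rpow_const fun x _ => Or.inr hq.le
  -- derivative vanishes at the midpoint
  have hm0 : u' (L / 2) = 0 := by
    have h1 := hd1 _ (Set.Ioo_subset_Icc_self hmid)
    have h2 : HasDerivAt (fun x => u (L - x)) (-u' (L / 2)) (L / 2) := by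
      have h3 : HasDerivAt u (u' (L / 2)) (L - L / 2) := by
        rw [show L - L / 2 = L / 2 by ring]; exact h1
      exact h3.comp_const_sub L (L / 2)
    have h4 : u =ᶠ[nhds (L / 2)] fun x => u (L - x) := by
      filter_upwards [Ioo_mem_nhds hmid.1 hmid.2] with x hx
      exact hsym x (Set.Ioo_subset_Icc_self hx)
    have := h1.unique (h2.congr_of_eventuallyEq h4)
    linarith
  -- energy
  have hE : ∀ x ∈ Set.Icc (0 : ℝ) L,
      u' x ^ 2 + 2 * mu / (p + 1) * u x ^ (p + 1) = 2 * mu / (p + 1) * A ^ (p + 1) := by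
    have hder : ∀ x ∈ Set.Icc (0 : ℝ) L,
        HasDerivAt (fun x => u' x ^ 2 + 2 * mu / (p + 1) * u x ^ (p + 1)) 0 x := by
      intro x hx
      have h1 := (hd2 x hx).fun_pow 2
      have h2 := ((hd1 x hx).rpow_const (p := p + 1) (Or.inr (by linarith))).const_mul
        (2 * mu / (p + 1))
      refine (h1.add h2).congr_deriv ?_
      have h3 : u'' x = - (mu * u x ^ p) := by linarith [heq x hx]
      rw [h3, show p + 1 - 1 = p by ring]
      field_simp
      push_cast
      ring
    have hconst := constant_of_has_deriv_right_zero
      (fun x hx => (hder x hx).continuousAt.continuousWithinAt)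
      (fun x hx => (hder x (Set.Ico_subset_Icc_self hx)).hasDerivWithinAt)
    intro x hx
    rw [hconst x hx, ← hconst (L / 2) (Set.Ioo_subset_Icc_self hmid), hm0]
    simp [hAdef]
  -- integration by parts
  have hIBP : (∫ x in (0 : ℝ)..L, (u' x) ^ 2) = mu * ∫ x in (0 : ℝ)..L, u x ^ (p + 1) := by
    have i1 : IntervalIntegrable (fun x => u' x ^ 2) MeasureTheory.volume 0 L :=
      (ContinuousOn.pow (by rwa [Set.uIcc_of_le hL.le]) 2).intervalIntegrable
    have i2 : IntervalIntegrable (fun x => mu * u x ^ (p + 1)) MeasureTheory.volume 0 L :=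
      (ContinuousOn.mul continuousOn_const (by rwa [Set.uIcc_of_le hL.le])).intervalIntegrable
    have h := intervalIntegral.integral_eq_sub_of_hasDerivAt (a := 0) (b := L)
      (f := fun x => u x * u' x) (f' := fun x => u' x ^ 2 - mu * u x ^ (p + 1)) (by
        intro x hx
        rw [Set.uIcc_of_le hL.le] at hx
        refine ((hd1 x hx).mul (hd2 x hx)).congr_deriv ?_
        have h3 : u'' x = - (mu * u x ^ p) := by linarith [heq x hx]
        rw [h3, Real.rpow_add_one' (hnn x hx) hq.ne']
        ring) (i1.sub i2)
    rw [intervalIntegral.integral_sub i1 i2, intervalIntegral.integral_const_mul, hu0, huL] at h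
    linarith
  -- symmetry
  have hhalf : (∫ x in (0 : ℝ)..L, u x ^ (p + 1)) = 2 * ∫ x in (0 : ℝ)..(L / 2), u x ^ (p + 1) := by
    have s1 : Set.uIcc 0 (L / 2) ⊆ Set.Icc 0 L := by
      rw [Set.uIcc_of_le hL2.le]; exact Set.Icc_subset_Icc_right (by linarith)
    have s2 : Set.uIcc (L / 2) L ⊆ Set.Icc 0 L := by
      rw [Set.uIcc_of_le (by linarith)]; exact Set.Icc_subset_Icc_left (by linarith)
    rw [← intervalIntegral.integral_add_adjacent_intervals
      (cuq.mono s1).intervalIntegrable (cuq.mono s2).intervalIntegrable]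
    have h := intervalIntegral.integral_comp_sub_left (a := 0) (b := L / 2)
      (fun x => u x ^ (p + 1)) L
    rw [show L - L / 2 = L / 2 by ring, sub_zero] at h
    rw [← h]
    have h' : (∫ x in (0 : ℝ)..(L / 2), u (L - x) ^ (p + 1)) =
        ∫ x in (0 : ℝ)..(L / 2), u x ^ (p + 1) := by
      apply intervalIntegral.integral_congr
      intro x hx
      simp only
      rw [← hsym x (s1 hx)]
    rw [h']; ring
  have hmonoOn : StrictMonoOn u (Set.Icc 0 (L / 2)) := by
    apply strictMonoOn_of_deriv_pos (convex_Icc _ _)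
      (cu.mono (Set.Icc_subset_Icc_right (by linarith)))
    intro x hx
    rw [interior_Icc] at hx
    rw [(hd1 x ⟨hx.1.le, by linarith [hx.2]⟩).deriv]
    exact hmono x hx
  set f : ℝ → ℝ := fun x => (u x / A) ^ (p + 1) with hf
  have hsub : Set.Ioo 0 (L / 2) ⊆ Set.Icc 0 L := fun x hx => ⟨hx.1.le, by linarith [hx.2]⟩
  have hfmono : StrictMonoOn f (Set.Icc 0 (L / 2)) := by
    intro x hx y hy hxy
    have h0 : 0 ≤ u x := hnn x ⟨hx.1, by linarith [hx.2]⟩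
    exact Real.rpow_lt_rpow (by positivity)
      (div_lt_div_of_pos_right (hmonoOn hx hy hxy) hA) hq
  have hf0 : f 0 = 0 := by simp [hf, hu0, Real.zero_rpow hq.ne']
  have hf1 : f (L / 2) = 1 := by
    simp only [hf]; rw [← hAdef, div_self hA.ne', Real.one_rpow]
  have himg : f '' Set.Ioo 0 (L / 2) = Set.Ioo 0 1 := by
    apply Set.Subset.antisymm
    · rintro _ ⟨x, hx, rfl⟩
      constructor
      · rw [← hf0]
        exact hfmono (Set.left_mem_Icc.2 hL2.le) (Set.Ioo_subset_Icc_self hx) hx.1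
      · rw [← hf1]
        exact hfmono (Set.Ioo_subset_Icc_self hx) (Set.right_mem_Icc.2 hL2.le) hx.2
    · have hcf : ContinuousOn f (Set.Icc 0 (L / 2)) := by
        apply ContinuousOn.rpow_const
        · exact (cu.mono (Set.Icc_subset_Icc_right (by linarith))).div_const A
        · intro x _; exact Or.inr hq.le
      have := intermediate_value_Ioo hL2.le hcf
      rwa [hf0, hf1] at this
  have hfd : ∀ x ∈ Set.Ioo 0 (L / 2), HasDerivWithinAt f
      (u' x / A * (p + 1) * (u x / A) ^ (p + 1 - 1)) (Set.Ioo 0 (L / 2)) x := fun x hx =>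
    (((hd1 x (hsub hx)).div_const A).rpow_const (p := p + 1)
      (Or.inr (by linarith))).hasDerivWithinAt
  have hcv := fun g : ℝ → ℝ => MeasureTheory.integral_image_eq_integral_abs_deriv_smul
    measurableSet_Ioo hfd (hfmono.injOn.mono Set.Ioo_subset_Icc_self) g
  rw [himg] at hcv
  set W := √(2 * mu / (p + 1) * A ^ (p + 1)) with hW
  have hWpos : 0 < W := by rw [hW]; positivity
  have hW2 : W ^ 2 = 2 * mu / (p + 1) * A ^ (p + 1) := Real.sq_sqrt (by positivity)
  set K := (p + 1) * W / A with hK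
  have hKpos : 0 < K := by positivity
  have hpt : ∀ x ∈ Set.Ioo 0 (L / 2), |u' x / A * (p + 1) * (u x / A) ^ (p + 1 - 1)| *
      (f x ^ (1 / (p + 1) - 1) * (1 - f x) ^ ((1 : ℝ) / 2 - 1)) = K := by
    intro x hx
    refine ef_pointwise (p + 1) A (u x) W (u' x) hq hA (hpos x ⟨hx.1, by linarith [hx.2]⟩)
      (hmonoOn (Set.Ioo_subset_Icc_self hx) (Set.right_mem_Icc.2 hL2.le) hx.2) hWpos (hmono x hx) ?_
    rw [hW2, Real.div_rpow (hnn x (hsub hx)) hA.le]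
    have := hE x (hsub hx)
    have hAq : A ^ (p + 1) ≠ 0 := by positivity
    rw [mul_one_sub, mul_assoc, mul_div_cancel₀ _ hAq]
    linarith
  have hB1 : eulerBeta (1 / (p + 1)) (1 / 2) = K * (L / 2) := by
    unfold eulerBeta
    rw [intervalIntegral.integral_of_le zero_le_one, MeasureTheory.integral_Ioc_eq_integral_Ioo, hcv,
      MeasureTheory.setIntegral_congr_fun measurableSet_Ioo
        (g := fun _ => K) (fun x hx => by simpa only [smul_eq_mul] using hpt x hx)]
    simp [hL2.le, mul_comm]
  have hB2 : eulerBeta ((p + 2) / (p + 1)) (1 / 2) =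
      K * ((∫ x in (0 : ℝ)..L, u x ^ (p + 1)) / (2 * A ^ (p + 1))) := by
    unfold eulerBeta
    rw [intervalIntegral.integral_of_le zero_le_one, MeasureTheory.integral_Ioc_eq_integral_Ioo, hcv,
      MeasureTheory.setIntegral_congr_fun measurableSet_Ioo
        (g := fun x => K / A ^ (p + 1) * u x ^ (p + 1)) ?_, ← MeasureTheory.integral_Ioc_eq_integral_Ioo,
      ← intervalIntegral.integral_of_le hL2.le, intervalIntegral.integral_const_mul, hhalf]
    · field_simp
    · intro x hx
      have hux : 0 < u x := hpos x ⟨hx.1, by linarith [hx.2]⟩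
      have hfx : 0 < f x := by simp only [hf]; positivity
      simp only [smul_eq_mul]
      rw [show (p + 2) / (p + 1) - 1 = (1 / (p + 1) - 1) + 1 by field_simp; ring,
        Real.rpow_add_one hfx.ne']
      calc _ = |u' x / A * (p + 1) * (u x / A) ^ (p + 1 - 1)| *
            (f x ^ (1 / (p + 1) - 1) * (1 - f x) ^ ((1 : ℝ) / 2 - 1)) * f x := by ring
        _ = _ := by
          rw [hpt x hx]
          simp only [hf]
          rw [Real.div_rpow hux.le hA.le]
          ring
  have hUpos : 0 < ∫ x in (0 : ℝ)..L, u x ^ (p + 1) := by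
    apply intervalIntegral.intervalIntegral_pos_of_pos_on _ _ hL
    · apply ContinuousOn.intervalIntegrable
      rwa [Set.uIcc_of_le hL.le]
    · intro x hx
      exact Real.rpow_pos_of_pos (hpos x hx) _
  rw [hIBP]
  refine ef_final L mu p A K _ _ _ hL hmu hp hA hKpos hUpos hB1 hB2 ?_
  rw [hK, div_pow, mul_pow, hW2]
  field_simp
end
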